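/- Every type-2 configuration of [2,1,1] admits a proper 5-coloring. -/

import Mathlib

/-- A cuboid with integer root and integer dimensions. -/
structure Cuboid where
  root : ℤ × ℤ × ℤ
  dims : ℤ × ℤ × ℤ
deriving DecidableEq

namespace Cuboid

/-- The dimensions are positive. -/
def valid (C : Cuboid) : Prop :=
  0 < C.dims.1 ∧ 0 < C.dims.2.1 ∧ 0 < C.dims.2.2

/-- The closed cuboid `[x,x+a] × [y,y+b] × [z,z+c] ⊆ ℝ³`. -/
def toSet (C : Cuboid) : Set (ℝ × ℝ × ℝ) :=
  {p | (C.root.1 : ℝ) ≤ p.1 ∧ p.1 ≤ C.root.1 + C.dims.1 ∧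
       (C.root.2.1 : ℝ) ≤ p.2.1 ∧ p.2.1 ≤ C.root.2.1 + C.dims.2.1 ∧
       (C.root.2.2 : ℝ) ≤ p.2.2 ∧ p.2.2 ≤ C.root.2.2 + C.dims.2.2}

/-- The open cuboid `(x,x+a) × (y,y+b) × (z,z+c) ⊆ ℝ³` (the interior). -/
def inte (C : Cuboid) : Set (ℝ × ℝ × ℝ) :=
  {p | (C.root.1 : ℝ) < p.1 ∧ p.1 < C.root.1 + C.dims.1 ∧
       (C.root.2.1 : ℝ) < p.2.1 ∧ p.2.1 < C.root.2.1 + C.dims.2.1 ∧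
       (C.root.2.2 : ℝ) < p.2.2 ∧ p.2.2 < C.root.2.2 + C.dims.2.2}

/-- The set `(ℤ×ℤ×ℝ) ∪ (ℤ×ℝ×ℤ) ∪ (ℝ×ℤ×ℤ)` of grid lines. -/
def grid : Set (ℝ × ℝ × ℝ) :=
  {p | ((∃ m : ℤ, p.1 = m) ∧ (∃ n : ℤ, p.2.1 = n)) ∨
       ((∃ m : ℤ, p.1 = m) ∧ (∃ n : ℤ, p.2.2 = n)) ∨
       ((∃ m : ℤ, p.2.1 = m) ∧ (∃ n : ℤ, p.2.2 = n))}

/-- Two cuboids collide when their interiors intersect. -/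
def Collide (C D : Cuboid) : Prop := (C.inte ∩ D.inte).Nonempty

/-- Two cuboids touch when their interiors are disjoint but their intersection
contains a point outside the grid lines (i.e. it is a non-degenerate rectangle). -/
def Touch (C D : Cuboid) : Prop :=
  ¬ Collide C D ∧ ∃ p ∈ C.toSet ∩ D.toSet, p ∉ grid

end Cuboid

/-- A configuration: a finite family of valid pairwise non-colliding cuboids. -/
def IsConfig (F : Finset Cuboid) : Prop :=
  (∀ C ∈ F, C.valid) ∧ ∀ C ∈ F, ∀ D ∈ F, C ≠ D → ¬ Cuboid.Collide C D

/-- A type-1 configuration of `[a,b,c]`: every cuboid has dimensions exactly `(a,b,c)`. -/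
def Type1 (a b c : ℕ) (F : Finset Cuboid) : Prop :=
  ∀ C ∈ F, C.dims = ((a : ℤ), (b : ℤ), (c : ℤ))

/-- A type-2 configuration of `[a,b,c]`: every cuboid has dimensions `(a,b,c)` or `(b,a,c)`. -/
def Type2 (a b c : ℕ) (F : Finset Cuboid) : Prop :=
  ∀ C ∈ F, C.dims = ((a : ℤ), (b : ℤ), (c : ℤ)) ∨ C.dims = ((b : ℤ), (a : ℤ), (c : ℤ))

/-- A type-3 configuration of `[a,b,c]`: every cuboid's dimensions are a permutation of `(a,b,c)`. -/
def Type3 (a b c : ℕ) (F : Finset Cuboid) : Prop :=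
  ∀ C ∈ F, C.dims = ((a : ℤ), (b : ℤ), (c : ℤ)) ∨ C.dims = ((a : ℤ), (c : ℤ), (b : ℤ)) ∨
    C.dims = ((b : ℤ), (a : ℤ), (c : ℤ)) ∨ C.dims = ((b : ℤ), (c : ℤ), (a : ℤ)) ∨
    C.dims = ((c : ℤ), (a : ℤ), (b : ℤ)) ∨ C.dims = ((c : ℤ), (b : ℤ), (a : ℤ))

/-- A proper `k`-coloring of a configuration: touching cuboids get distinct colors. -/
def ProperColoring (k : ℕ) (F : Finset Cuboid) : Prop :=
  ∃ κ : Cuboid → Fin k, ∀ C ∈ F, ∀ D ∈ F, Cuboid.Touch C D → κ C ≠ κ D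

/-- If a real point lies in the integer intervals `[a, b]` and `[c, d]`, then either their
endpoints interlace strictly, or the point is an integer. -/
theorem lt_and_lt_or_exists_int_of_mem {a b c d : ℤ} {p : ℝ} (h₁ : (a : ℝ) ≤ p)
    (h₂ : p ≤ b) (h₃ : (c : ℝ) ≤ p) (h₄ : p ≤ d) :
    (a < d ∧ c < b) ∨ (∃ m : ℤ, p = m) := by
  by_cases h : a < d ∧ c < b
  · exact Or.inl h
  · right
    rcases not_and_or.1 h with h | h
    · have : (d : ℝ) ≤ a := by exact_mod_cast not_lt.1 h
      exact ⟨a, by linarith⟩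
    · have : (b : ℝ) ≤ c := by exact_mod_cast not_lt.1 h
      exact ⟨c, by linarith⟩

/-- Overlapping integer intervals have a common interior point. -/
theorem exists_real_mem_of_lt {a b c d : ℤ} (hab : a < b) (hcd : c < d) (had : a < d)
    (hcb : c < b) : ∃ p : ℝ, (a : ℝ) < p ∧ p < b ∧ (c : ℝ) < p ∧ p < d := by
  obtain ⟨p, h, h'⟩ := exists_between (show max (a : ℝ) c < min (b : ℝ) d by
    simp only [max_lt_iff, lt_min_iff]
    norm_cast)
  rw [max_lt_iff] at h
  rw [lt_min_iff] at h'
  exact ⟨p, h.1, h'.1, h.2, h'.2⟩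

namespace Cuboid

/-- The projections `[a, a + m]` and `[b, b + n]` of two cuboids to a coordinate axis overlap in an
interval of positive length. -/
def Overlap (a m b n : ℤ) : Prop := a < b + n ∧ b < a + m

theorem collide_of_overlap {C D : Cuboid} (hC : C.valid) (hD : D.valid)
    (hx : Overlap C.root.1 C.dims.1 D.root.1 D.dims.1)
    (hy : Overlap C.root.2.1 C.dims.2.1 D.root.2.1 D.dims.2.1)
    (hz : Overlap C.root.2.2 C.dims.2.2 D.root.2.2 D.dims.2.2) : Collide C D := by
  obtain ⟨hC₁, hC₂, hC₃⟩ := hC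
  obtain ⟨hD₁, hD₂, hD₃⟩ := hD
  obtain ⟨p, hp⟩ := exists_real_mem_of_lt (lt_add_of_pos_right _ hC₁)
    (lt_add_of_pos_right _ hD₁) hx.1 hx.2
  obtain ⟨q, hq⟩ := exists_real_mem_of_lt (lt_add_of_pos_right _ hC₂)
    (lt_add_of_pos_right _ hD₂) hy.1 hy.2
  obtain ⟨r, hr⟩ := exists_real_mem_of_lt (lt_add_of_pos_right _ hC₃)
    (lt_add_of_pos_right _ hD₃) hz.1 hz.2
  push_cast at hp hq hr
  exact ⟨(p, q, r), ⟨hp.1, hp.2.1, hq.1, hq.2.1, hr.1, hr.2.1⟩,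
    ⟨hp.2.2.1, hp.2.2.2, hq.2.2.1, hq.2.2.2, hr.2.2.1, hr.2.2.2⟩⟩

/-- The projections of touching cuboids meet in every direction, overlap in at least two
directions, and do not overlap in all three. -/
theorem Touch.overlap {C D : Cuboid} (h : Touch C D) (hC : C.valid) (hD : D.valid) :
    (C.root.1 ≤ D.root.1 + D.dims.1 ∧ D.root.1 ≤ C.root.1 + C.dims.1) ∧
    (C.root.2.1 ≤ D.root.2.1 + D.dims.2.1 ∧ D.root.2.1 ≤ C.root.2.1 + C.dims.2.1) ∧
    (C.root.2.2 ≤ D.root.2.2 + D.dims.2.2 ∧ D.root.2.2 ≤ C.root.2.2 + C.dims.2.2) ∧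
    (Overlap C.root.1 C.dims.1 D.root.1 D.dims.1 ∨
      Overlap C.root.2.1 C.dims.2.1 D.root.2.1 D.dims.2.1) ∧
    (Overlap C.root.1 C.dims.1 D.root.1 D.dims.1 ∨
      Overlap C.root.2.2 C.dims.2.2 D.root.2.2 D.dims.2.2) ∧
    (Overlap C.root.2.1 C.dims.2.1 D.root.2.1 D.dims.2.1 ∨
      Overlap C.root.2.2 C.dims.2.2 D.root.2.2 D.dims.2.2) ∧
    ¬ (Overlap C.root.1 C.dims.1 D.root.1 D.dims.1 ∧
      Overlap C.root.2.1 C.dims.2.1 D.root.2.1 D.dims.2.1 ∧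
      Overlap C.root.2.2 C.dims.2.2 D.root.2.2 D.dims.2.2) := by
  obtain ⟨hn, p, ⟨⟨c₁, c₂, c₃, c₄, c₅, c₆⟩, ⟨d₁, d₂, d₃, d₄, d₅, d₆⟩⟩, hp⟩ := h
  have hx := lt_and_lt_or_exists_int_of_mem c₁ (b := C.root.1 + C.dims.1) (by push_cast; exact c₂)
    d₁ (d := D.root.1 + D.dims.1) (by push_cast; exact d₂)
  have hy := lt_and_lt_or_exists_int_of_mem c₃ (b := C.root.2.1 + C.dims.2.1)
    (by push_cast; exact c₄) d₃ (d := D.root.2.1 + D.dims.2.1) (by push_cast; exact d₄)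
  have hz := lt_and_lt_or_exists_int_of_mem c₅ (b := C.root.2.2 + C.dims.2.2)
    (by push_cast; exact c₆) d₅ (d := D.root.2.2 + D.dims.2.2) (by push_cast; exact d₆)
  refine ⟨⟨?_, ?_⟩, ⟨?_, ?_⟩, ⟨?_, ?_⟩, ?_, ?_, ?_, fun h => hn ?_⟩
  · exact_mod_cast c₁.trans d₂
  · exact_mod_cast d₁.trans c₂
  · exact_mod_cast c₃.trans d₄
  · exact_mod_cast d₃.trans c₄
  · exact_mod_cast c₅.trans d₆
  · exact_mod_cast d₅.trans c₆
  · exact hx.elim Or.inl fun hx => hy.elim Or.inr fun hy => (hp (Or.inl ⟨hx, hy⟩)).elim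
  · exact hx.elim Or.inl fun hx => hz.elim Or.inr fun hz => (hp (Or.inr (Or.inl ⟨hx, hz⟩))).elim
  · exact hy.elim Or.inl fun hy => hz.elim Or.inr fun hz => (hp (Or.inr (Or.inr ⟨hy, hz⟩))).elim
  · exact collide_of_overlap hC hD h.1 h.2.1 h.2.2

/-- The residue of `x + 7 y + 5 z` modulo `10` at the root of a cuboid. -/
def residue (C : Cuboid) : ZMod 10 :=
  ((C.root.1 + 7 * C.root.2.1 + 5 * C.root.2.2 : ℤ) : ZMod 10)

/-- The color of a brick with dimensions `(2, 1, 1)`, as a function of its residue. -/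
def colorX : ZMod 10 → Fin 5 := ![4, 4, 3, 3, 2, 2, 1, 1, 0, 0]

/-- The color of a brick with dimensions `(1, 2, 1)`, as a function of its residue. -/
def colorY : ZMod 10 → Fin 5 := ![1, 4, 0, 3, 4, 2, 3, 1, 2, 0]

/-- A coloring of the `(2, 1, 1)` and `(1, 2, 1)` bricks, periodic in their root. -/
def brickColor (C : Cuboid) : Fin 5 :=
  if C.dims.1 = 2 then colorX C.residue else colorY C.residue

theorem residue_eq_add (C D : Cuboid) : D.residue = C.residue +
    ((D.root.1 - C.root.1 + 7 * (D.root.2.1 - C.root.2.1) +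
      5 * (D.root.2.2 - C.root.2.2) : ℤ) : ZMod 10) := by
  simp only [residue]
  push_cast
  ring

theorem brickColor_ne_of_touch {C D : Cuboid}
    (hC : C.dims = (2, 1, 1) ∨ C.dims = (1, 2, 1))
    (hD : D.dims = (2, 1, 1) ∨ D.dims = (1, 2, 1)) (h : Touch C D) :
    C.brickColor ≠ D.brickColor := by
  have valid_of {E : Cuboid} (hE : E.dims = (2, 1, 1) ∨ E.dims = (1, 2, 1)) : E.valid := by
    rcases hE with hE | hE <;> simp [valid, hE]
  have key := h.overlap (valid_of hC) (valid_of hD)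
  have hr := residue_eq_add C D
  unfold brickColor
  rw [hr]
  generalize C.residue = t
  generalize hu : D.root.1 - C.root.1 = u
  generalize hv : D.root.2.1 - C.root.2.1 = v
  generalize hw : D.root.2.2 - C.root.2.2 = w
  clear hr
  rcases hC with hC | hC <;> rcases hD with hD | hD <;>
  · simp only [hC, hD, Overlap] at key ⊢
    have hu₁ : -2 ≤ u := by omega
    have hu₂ : u ≤ 2 := by omega
    have hv₁ : -2 ≤ v := by omega
    have hv₂ : v ≤ 2 := by omega
    have hw₁ : -1 ≤ w := by omega
    have hw₂ : w ≤ 1 := by omega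
    interval_cases u <;> interval_cases v <;> interval_cases w <;>
      first
      | omega
      | (clear * -; revert t; decide)

end Cuboid

/-- Every type-2 configuration of `[2,1,1]` admits a proper 5-coloring. -/
theorem type2_211_5colorable :
    ∀ F : Finset Cuboid, IsConfig F → Type2 2 1 1 F → ProperColoring 5 F := by
  intro F _ hF
  exact ⟨Cuboid.brickColor, fun C hC D hD h =>
    Cuboid.brickColor_ne_of_touch (by simpa using hF C hC) (by simpa using hF D hD) h⟩
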